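/- Let G be an FDES (the uncontrolled system) and let R1, R2 be FDESs (the lower- and upper-bound specifications), all over the same finite event set E, with R1 ⊆ R2, and let Σuc : E → [0,1] be a degree-of-uncontrollability assignment. Then there exists a fuzzy Σuc-compatible FDES S over E (with some finite number of states) such that R1 ⊆ G || S and G || S ⊆ R2 if and only if R1 ⊆ G and G || R1⁺ ⊆ R2. -/

import Mathlib

open unitInterval

/-- A fuzzy discrete event system (FDES) over event set `E` with crisp state
index type `S`: fuzzy initial state vector, fuzzy marked state vector, and an
`S × S` fuzzy event matrix for each event, with entries in `[0,1]`. -/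
structure FDES (E : Type) (S : Type) where
  x0 : S → unitInterval
  xm : S → unitInterval
  sig : E → S → S → unitInterval

/-- Max-min product of matrices over `[0,1]`. -/
noncomputable def maxmin {α β γ : Type} [Fintype β]
    (A : α → β → unitInterval) (B : β → γ → unitInterval) : α → γ → unitInterval :=
  fun i k => Finset.univ.sup fun j => A i j ⊓ B j k

/-- Max-min product of a (row) vector with a matrix. -/
noncomputable def vecMat {β γ : Type} [Fintype β]
    (x : β → unitInterval) (B : β → γ → unitInterval) : γ → unitInterval :=
  fun k => Finset.univ.sup fun j => x j ⊓ B j k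

/-- `φ` is a fuzzy simulation from `G1` to `G2`:
(a) `x01 ≤ x02 ⊙ φᵀ`, (b) `xm1 ⊙ φ ≤ xm2`, (c) `φᵀ ⊙ σ1(e) ≤ σ2(e) ⊙ φᵀ` for all `e`. -/
def IsFuzzySim {E S1 S2 : Type} [Fintype S1] [Fintype S2]
    (G1 : FDES E S1) (G2 : FDES E S2) (φ : S1 → S2 → unitInterval) : Prop :=
  (∀ i, G1.x0 i ≤ Finset.univ.sup fun j => G2.x0 j ⊓ φ i j) ∧
  (∀ j, (Finset.univ.sup fun i => G1.xm i ⊓ φ i j) ≤ G2.xm j) ∧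
  (∀ e : E, ∀ j i, (Finset.univ.sup fun i' => φ i' j ⊓ G1.sig e i' i)
      ≤ Finset.univ.sup fun j' => G2.sig e j j' ⊓ φ i j')

/-- `G1 ⊆ G2`: some fuzzy simulation from `G1` to `G2` exists. -/
def Sim {E S1 S2 : Type} [Fintype S1] [Fintype S2]
    (G1 : FDES E S1) (G2 : FDES E S2) : Prop :=
  ∃ φ, IsFuzzySim G1 G2 φ

/-- Fuzzy tensor of two matrices over `[0,1]`. -/
noncomputable def ftensor {α β γ δ : Type} (A : α → β → unitInterval) (B : γ → δ → unitInterval) :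
    α × γ → β × δ → unitInterval :=
  fun p q => A p.1 q.1 ⊓ B p.2 q.2

/-- Parallel composition of two FDESs over the same event set. -/
noncomputable def par {E S1 S2 : Type} (G1 : FDES E S1) (G2 : FDES E S2) : FDES E (S1 × S2) where
  x0 := fun p => G1.x0 p.1 ⊓ G2.x0 p.2
  xm := fun p => G1.xm p.1 ⊓ G2.xm p.2
  sig := fun e => ftensor (G1.sig e) (G2.sig e)

/-- The fuzzy state vector reached after executing the word `s`. -/
noncomputable def run {E S : Type} [Fintype S] (G : FDES E S) (s : List E) : S → unitInterval :=
  s.foldl (fun v e => vecMat v (G.sig e)) G.x0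

/-- The fuzzy language generated by `G`. -/
noncomputable def lang {E S : Type} [Fintype S] (G : FDES E S) : List E → unitInterval
  | [] => 1
  | e :: s => Finset.univ.sup fun i => run G (e :: s) i

/-- `S` is fuzzy `Suc`-compatible: every row of every event matrix has an entry
at least the degree of uncontrollability of that event. -/
def Compatible {E S : Type} [Fintype S] (G : FDES E S) (Suc : E → unitInterval) : Prop :=
  ∀ (e : E) (i : S), Suc e ≤ Finset.univ.sup fun j => G.sig e i j

/-- The augmented FDES `R⁺` obtained from `R` by adding one extra crisp state
(`none`), following Algorithm 1. -/
noncomputable def Rplus {E S : Type} [Fintype S] (R : FDES E S) (Suc : E → unitInterval) :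
    FDES E (Option S) where
  x0 := fun s => match s with | some i => R.x0 i | none => 0
  xm := fun s => match s with | some i => R.xm i | none => 0
  sig := fun e p q => match p, q with
    | some i, some j => R.sig e i j
    | none, some _ => 0
    | none, none => Suc e
    | some i, none =>
        if Suc e ≤ Finset.univ.sup (fun j => R.sig e i j) then 0 else Suc e

section FDESPreorder

variable {E S1 S2 S3 : Type} [Fintype S1] [Fintype S2] [Fintype S3]

/-- A map of crisp states under which all degrees can only grow induces a fuzzy simulation. -/
theorem Sim.of_map {G1 : FDES E S1} {G2 : FDES E S2} (f : S1 → S2)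
    (h0 : ∀ i, G1.x0 i ≤ G2.x0 (f i)) (hm : ∀ i, G1.xm i ≤ G2.xm (f i))
    (hs : ∀ e i i', G1.sig e i i' ≤ G2.sig e (f i) (f i')) : Sim G1 G2 := by
  classical
  refine ⟨fun i j => if f i = j then ⊤ else ⊥, fun i => ?_, fun j => ?_, fun e j i => ?_⟩
  · refine le_trans ?_ (Finset.le_sup (Finset.mem_univ (f i)))
    simpa using h0 i
  · refine Finset.sup_le fun i _ => ?_
    by_cases h : f i = j
    · subst h
      simpa using hm i
    · simp [h]
  · refine Finset.sup_le fun i' _ => ?_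
    by_cases h : f i' = j
    · subst h
      refine le_trans ?_ (Finset.le_sup (Finset.mem_univ (f i)))
      simpa using hs e i' i
    · simp [h]

theorem Sim.trans {G1 : FDES E S1} {G2 : FDES E S2} {G3 : FDES E S3}
    (h : Sim G1 G2) (h' : Sim G2 G3) : Sim G1 G3 := by
  obtain ⟨φ, h0, hm, hs⟩ := h
  obtain ⟨ψ, h0', hm', hs'⟩ := h'
  have le_comp : ∀ i j k, φ i j ⊓ ψ j k ≤ maxmin φ ψ i k := fun i j k =>
    Finset.le_sup (f := fun j => φ i j ⊓ ψ j k) (Finset.mem_univ j)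
  refine ⟨maxmin φ ψ, fun i => (h0 i).trans ?_, fun k => ?_, fun e k i => ?_⟩
  · refine Finset.sup_le fun j _ => (inf_le_inf_right _ (h0' j)).trans ?_
    rw [Finset.sup_inf_distrib_right]
    refine Finset.sup_mono_fun fun k _ => ?_
    rw [inf_assoc, inf_comm (ψ j k)]
    exact inf_le_inf_left _ (le_comp i j k)
  · refine Finset.sup_le fun i _ => ?_
    rw [maxmin, Finset.sup_inf_distrib_left]
    refine Finset.sup_le fun j _ => ?_
    rw [← inf_assoc]
    refine (inf_le_inf_right _ ?_).trans ((Finset.sup_le_iff.1 (hm' k)) j (Finset.mem_univ j))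
    exact Finset.sup_le_iff.1 (hm j) i (Finset.mem_univ i)
  · refine Finset.sup_le fun i' _ => ?_
    rw [maxmin, Finset.sup_inf_distrib_right]
    refine Finset.sup_le fun j _ => ?_
    rw [inf_right_comm]
    refine (inf_le_inf_right _ (Finset.sup_le_iff.1 (hs e j i) i' (Finset.mem_univ i'))).trans ?_
    rw [Finset.sup_inf_distrib_right]
    refine Finset.sup_le fun j' _ => ?_
    rw [inf_comm, ← inf_assoc]
    refine (inf_le_inf_right _ (Finset.sup_le_iff.1 (hs' e k j') j (Finset.mem_univ j))).trans ?_
    rw [Finset.sup_inf_distrib_right]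
    refine Finset.sup_mono_fun fun k' _ => ?_
    rw [inf_assoc, inf_comm (ψ j' k')]
    exact inf_le_inf_left _ (le_comp i j' k')

theorem sim_par_fst (G : FDES E S1) (H : FDES E S2) : Sim (par G H) G :=
  Sim.of_map Prod.fst (fun _ => inf_le_left) (fun _ => inf_le_left) fun _ _ _ => inf_le_left

theorem sim_par_snd (G : FDES E S1) (H : FDES E S2) : Sim (par G H) H :=
  Sim.of_map Prod.snd (fun _ => inf_le_right) (fun _ => inf_le_right) fun _ _ _ => inf_le_right

theorem sup_inf_sup_le_sup_prod (f : S1 → unitInterval) (g : S2 → unitInterval) :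
    Finset.univ.sup f ⊓ Finset.univ.sup g ≤ Finset.univ.sup fun p : S1 × S2 => f p.1 ⊓ g p.2 := by
  rw [Finset.sup_inf_sup, Finset.univ_product_univ]

/-- Parallel composition is the greatest lower bound for fuzzy simulation. -/
theorem Sim.par {K : FDES E S1} {G : FDES E S2} {H : FDES E S3}
    (h : Sim K G) (h' : Sim K H) : Sim K (par G H) := by
  obtain ⟨φ, h0, hm, hs⟩ := h
  obtain ⟨ψ, h0', hm', hs'⟩ := h'
  refine ⟨fun i p => φ i p.1 ⊓ ψ i p.2, fun i => ?_, fun p => ?_, fun e p i => ?_⟩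
  · refine (le_inf (h0 i) (h0' i)).trans ((sup_inf_sup_le_sup_prod _ _).trans ?_)
    exact Finset.sup_mono_fun fun p _ => (inf_inf_inf_comm _ _ _ _).le
  · refine Finset.sup_le fun i _ => le_inf ?_ ?_
    · exact (inf_le_inf_left _ inf_le_left).trans
        (Finset.sup_le_iff.1 (hm p.1) i (Finset.mem_univ i))
    · exact (inf_le_inf_left _ inf_le_right).trans
        (Finset.sup_le_iff.1 (hm' p.2) i (Finset.mem_univ i))
  · refine Finset.sup_le fun i' _ => ?_
    refine (le_inf
      ((inf_le_inf_right _ inf_le_left).trans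
        (Finset.sup_le_iff.1 (hs e p.1 i) i' (Finset.mem_univ i')))
      ((inf_le_inf_right _ inf_le_right).trans
        (Finset.sup_le_iff.1 (hs' e p.2 i) i' (Finset.mem_univ i')))).trans
      ((sup_inf_sup_le_sup_prod _ _).trans ?_)
    exact Finset.sup_mono_fun fun q _ => (inf_inf_inf_comm _ _ _ _).le

theorem Sim.par_left (G : FDES E S1) {H : FDES E S2} {H' : FDES E S3} (h : Sim H H') :
    Sim (_root_.par G H) (_root_.par G H') :=
  (sim_par_fst G H).par ((sim_par_snd G H).trans h)

theorem sim_Rplus (R : FDES E S1) (Suc : E → unitInterval) : Sim R (Rplus R Suc) :=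
  Sim.of_map some (fun _ => le_rfl) (fun _ => le_rfl) fun _ _ _ => le_rfl

theorem compatible_Rplus (R : FDES E S1) (Suc : E → unitInterval) :
    Compatible (Rplus R Suc) Suc := by
  rintro e (_ | i)
  · exact Finset.le_sup (f := fun j => (Rplus R Suc).sig e none j) (Finset.mem_univ none)
  · by_cases h : Suc e ≤ Finset.univ.sup fun j => R.sig e i j
    · refine h.trans (Finset.sup_le fun j _ => ?_)
      exact Finset.le_sup (f := fun j => (Rplus R Suc).sig e (some i) j)
        (Finset.mem_univ (some j))
    · refine le_trans ?_ (Finset.le_sup (f := fun j => (Rplus R Suc).sig e (some i) j)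
        (Finset.mem_univ none))
      simp [Rplus, h]

/-- `Rplus R Suc` is the least compatible system above `R`. -/
theorem Rplus_sim {R : FDES E S1} {H : FDES E S2} {Suc : E → unitInterval}
    (hH : Compatible H Suc) (h : Sim R H) : Sim (Rplus R Suc) H := by
  obtain ⟨φ, h0, hm, hs⟩ := h
  refine ⟨fun o j => o.elim ⊤ fun i => φ i j, ?_, fun j => Finset.sup_le ?_,
    fun e j o => Finset.sup_le ?_⟩
  · rintro (_ | i)
    · exact bot_le
    · exact h0 i
  · rintro (_ | i) -
    · exact inf_le_left.trans bot_le
    · exact Finset.sup_le_iff.1 (hm j) i (Finset.mem_univ i)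
  · rintro q -
    rcases o with _ | i
    · have le_Suc : (Rplus R Suc).sig e q none ≤ Suc e := by
        rcases q with _ | k
        · exact le_rfl
        · simp only [Rplus]
          split_ifs
          · exact bot_le
          · exact le_rfl
      simpa using inf_le_right.trans (le_Suc.trans (hH e j))
    · rcases q with _ | k
      · exact inf_le_right.trans bot_le
      · exact Finset.sup_le_iff.1 (hs e j i) k (Finset.mem_univ k)

/-- Transport of a system along a relabelling of its crisp states. -/
def FDES.reindex (G : FDES E S1) (f : S1 ≃ S2) : FDES E S2 where
  x0 j := G.x0 (f.symm j)
  xm j := G.xm (f.symm j)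
  sig e j j' := G.sig e (f.symm j) (f.symm j')

theorem FDES.reindex_sim (G : FDES E S1) (f : S1 ≃ S2) : Sim (G.reindex f) G :=
  Sim.of_map f.symm (fun _ => le_rfl) (fun _ => le_rfl) fun _ _ _ => le_rfl

theorem FDES.sim_reindex (G : FDES E S1) (f : S1 ≃ S2) : Sim G (G.reindex f) :=
  Sim.of_map f (fun _ => by simp [reindex]) (fun _ => by simp [reindex])
    fun _ _ _ => by simp [reindex]

theorem Compatible.reindex {G : FDES E S1} {Suc : E → unitInterval} (h : Compatible G Suc)
    (f : S1 ≃ S2) : Compatible (G.reindex f) Suc := by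
  refine fun e i => (h e (f.symm i)).trans (Finset.sup_le fun j _ => ?_)
  refine le_trans ?_ (Finset.le_sup (Finset.mem_univ (f j)))
  simp [FDES.reindex]

end FDESPreorder

/-- "range" control: there exists a fuzzy `Suc`-compatible
supervisor `S` with `R1 ⊆ G || S ⊆ R2` iff `R1 ⊆ G` and `G || R1⁺ ⊆ R2`. -/
theorem stmt_13 {E SG S1 S2 : Type} [Fintype E] [Fintype SG] [Fintype S1] [Fintype S2]
    (G : FDES E SG) (R1 : FDES E S1) (R2 : FDES E S2) (Suc : E → unitInterval)
    (h12 : Sim R1 R2) :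
    (∃ (n : ℕ) (S : FDES E (Fin n)), Compatible S Suc ∧
        Sim R1 (par G S) ∧ Sim (par G S) R2) ↔
      (Sim R1 G ∧ Sim (par G (Rplus R1 Suc)) R2) := by
  constructor
  · rintro ⟨n, S, hS, hl, hu⟩
    exact ⟨hl.trans (sim_par_fst G S),
      (Sim.par_left G (Rplus_sim hS (hl.trans (sim_par_snd G S)))).trans hu⟩
  · rintro ⟨hG, hu⟩
    let f := Fintype.equivFin (Option S1)
    exact ⟨_, (Rplus R1 Suc).reindex f, (compatible_Rplus R1 Suc).reindex f,
      hG.par ((sim_Rplus R1 Suc).trans ((Rplus R1 Suc).sim_reindex f)),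
      (Sim.par_left G ((Rplus R1 Suc).reindex_sim f)).trans hu⟩
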